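/- Let K be a Henselian valued field whose residue field has characteristic 2, let Δ ⊆ Γ be convex, and let x ∈ K with v(x) = 0. If there exist y ∈ K and u₁, u₂ ∈ 1 + M_Δ with x = y²·u₁ + y·u₂ (i.e., the coset of x is an Artin–Schreier value in the Krasner hyperfield K/(1+M_Δ)), then there exists z ∈ K with x = z² + z. -/

import Mathlib

/-- `Δ ⊆ Γ₀` is (the multiplicative rendering of) a convex subset of the value group `Γ`
containing `0`: written multiplicatively, `1 ∈ Δ`, `0 ∉ Δ` (so `Δ` consists of group
elements), and `Δ` is upward closed (additively: downward closed). -/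
def IsConvexSubset {Γ₀ : Type*} [LinearOrderedCommGroupWithZero Γ₀] (Δ : Set Γ₀) : Prop :=
  (1 : Γ₀) ∈ Δ ∧ (0 : Γ₀) ∉ Δ ∧ ∀ a b : Γ₀, a ∈ Δ → a ≤ b → b ∈ Δ

/-- `MDelta v Δ = {x ∈ K : v(x) > δ for all δ ∈ Δ}` (multiplicatively: `v x < δ`). -/
def MDelta {K Γ₀ : Type*} [Field K] [LinearOrderedCommGroupWithZero Γ₀]
    (v : Valuation K Γ₀) (Δ : Set Γ₀) : Set K :=
  {x | ∀ δ ∈ Δ, v x < δ}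

/-- The coset `1 + M_Δ`. -/
def oneAddMDelta {K Γ₀ : Type*} [Field K] [LinearOrderedCommGroupWithZero Γ₀]
    (v : Valuation K Γ₀) (Δ : Set Γ₀) : Set K :=
  {u | ∃ m ∈ MDelta v Δ, u = 1 + m}

/-- A Henselian local ring has a root of `X² + X - x` near every approximate root, provided
`2` is in the maximal ideal. -/
theorem HenselianLocalRing.exists_eq_sq_add_self {R : Type*} [CommRing R] [HenselianLocalRing R]
    (h2 : (2 : R) ∈ IsLocalRing.maximalIdeal R) {x y : R}
    (hxy : y ^ 2 + y - x ∈ IsLocalRing.maximalIdeal R) : ∃ z : R, x = z ^ 2 + z := by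
  open Polynomial in
  have hmonic : (X ^ 2 + X - C x : R[X]).Monic := by monicity!
  obtain ⟨z, hz, -⟩ := HenselianLocalRing.is_henselian _ hmonic y (by simpa using hxy) (by
    have hu := IsLocalRing.isUnit_one_sub_self_of_mem_nonunits (-(2 * y))
      (neg_mem (Ideal.mul_mem_right y _ h2))
    convert hu using 1
    simp
    ring)
  refine ⟨z, ?_⟩
  simp only [Polynomial.IsRoot.def, Polynomial.eval_sub, Polynomial.eval_add,
    Polynomial.eval_pow, Polynomial.eval_X, Polynomial.eval_C] at hz
  linear_combination -hz

/-- An Artin–Schreier value up to `1`-units, if it is integral, is attained at an integral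
element. -/
theorem Valuation.le_one_of_sq_mul_add_mul_le_one {K Γ₀ : Type*} [Field K]
    [LinearOrderedCommGroupWithZero Γ₀] (v : Valuation K Γ₀) {y u₁ u₂ : K}
    (h₁ : v u₁ = 1) (h₂ : v u₂ = 1) (h : v (y ^ 2 * u₁ + y * u₂) ≤ 1) : v y ≤ 1 := by
  by_contra! hy
  have hlt : v (y * u₂) < v (y ^ 2 * u₁) := by
    simpa [h₁, h₂] using lt_self_pow₀ hy one_lt_two
  rw [v.map_add_eq_of_lt_left hlt, map_mul, map_pow, h₁, mul_one] at h
  exact (one_lt_pow₀ hy two_ne_zero).not_ge h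

/-- Let `K` be a Henselian valued field with residue characteristic `2`,
`Δ` convex, and `x ∈ K` with `v x = 0`.  If the coset of `x` is an Artin–Schreier value in
the Krasner hyperfield `K/(1+M_Δ)`, i.e. `x = y²·u₁ + y·u₂` with `u₁, u₂ ∈ 1 + M_Δ`, then
`x = z² + z` for some `z ∈ K`. -/
theorem artin_schreier_descends {K : Type*} [Field K] {Γ₀ : Type*}
    [LinearOrderedCommGroupWithZero Γ₀] (v : Valuation K Γ₀)
    [HenselianLocalRing v.valuationSubring]
    (hchar : ringChar (IsLocalRing.ResidueField v.valuationSubring) = 2)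
    (Δ : Set Γ₀) (hΔ : IsConvexSubset Δ)
    (x : K) (hx : v x = 1)
    (h : ∃ (y u₁ u₂ : K), u₁ ∈ oneAddMDelta v Δ ∧ u₂ ∈ oneAddMDelta v Δ ∧
      x = y ^ 2 * u₁ + y * u₂) :
    ∃ z : K, x = z ^ 2 + z := by
  obtain ⟨y, _, _, ⟨m₁, hm₁, rfl⟩, ⟨m₂, hm₂, rfl⟩, hxy⟩ := h
  replace hm₁ : v m₁ < 1 := hm₁ 1 hΔ.1
  replace hm₂ : v m₂ < 1 := hm₂ 1 hΔ.1
  have hy : v y ≤ 1 := v.le_one_of_sq_mul_add_mul_le_one (v.map_one_add_of_lt hm₁)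
    (v.map_one_add_of_lt hm₂) (hxy ▸ hx.le)
  have h2 : (2 : v.valuationSubring) ∈ IsLocalRing.maximalIdeal v.valuationSubring := by
    rw [← IsLocalRing.residue_eq_zero_iff, map_ofNat]
    simpa [hchar] using ringChar.Nat.cast_ringChar
      (R := IsLocalRing.ResidueField v.valuationSubring)
  let a : v.valuationSubring := ⟨x, hx.le⟩
  let b : v.valuationSubring := ⟨y, hy⟩
  let c₁ : v.valuationSubring := ⟨m₁, hm₁.le⟩
  let c₂ : v.valuationSubring := ⟨m₂, hm₂.le⟩
  have mem_max {m : K} (hm : v m < 1) :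
      (⟨m, hm.le⟩ : v.valuationSubring) ∈ IsLocalRing.maximalIdeal v.valuationSubring := by
    rw [IsLocalRing.mem_maximalIdeal, mem_nonunits_iff]
    intro hu
    exact hm.ne ((Valuation.integer.integers v).isUnit_iff_valuation_eq_one.mp hu)
  have hab : b ^ 2 + b - a = -(b ^ 2) * c₁ + -b * c₂ := by
    apply Subtype.ext
    change y ^ 2 + y - x = -(y ^ 2) * m₁ + -y * m₂
    linear_combination -hxy
  obtain ⟨z, hz⟩ := HenselianLocalRing.exists_eq_sq_add_self h2 (x := a) (y := b) (hab ▸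
    add_mem (Ideal.mul_mem_left _ _ (mem_max hm₁)) (Ideal.mul_mem_left _ _ (mem_max hm₂)))
  exact ⟨z, congrArg Subtype.val hz⟩
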